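/- arXiv:1706.08557 — 2 statements merged into one kernel-verified Lean document; each statement's English description precedes it below -/
import Mathlib

section
/- Let α1, α2 > 0, λ ≥ 0, set α⁺ = α1 + α2, and let r ∈ ℕ. Then _2F_2(α1+r, α⁺; α1, α⁺+r; λ/2) = Σ_{i=0}^{r} [binomial(r,i) · (α⁺)_i · (λ/2)^i / ((α1)_i · (α⁺+r)_i)] · _1F_1(α⁺+i; α⁺+r+i; λ/2). -/
open scoped Nat

/-- Ascending factorial (Pochhammer symbol) `(a)_n = a(a+1)⋯(a+n-1)` for a real `a`. -/
noncomputable def asc (a : ℝ) (n : ℕ) : ℝ := Polynomial.eval a (ascPochhammer ℝ n)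

/-- Kummer's confluent hypergeometric function `₁F₁(a;b;z)`. -/
noncomputable def F11 (a b z : ℝ) : ℝ := ∑' k : ℕ, asc a k / asc b k * z ^ k / (k ! : ℝ)

/-- Generalized hypergeometric function `₂F₂(a1,a2;b1,b2;z)`. -/
noncomputable def F22 (a1 a2 b1 b2 z : ℝ) : ℝ :=
  ∑' k : ℕ, (asc a1 k * asc a2 k) / (asc b1 k * asc b2 k) * z ^ k / (k ! : ℝ)

theorem asc_zero (a : ℝ) : asc a 0 = 1 := by simp [asc]

theorem asc_one (a : ℝ) : asc a 1 = a := by simp [asc]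

theorem asc_pos {a : ℝ} (ha : 0 < a) (n : ℕ) : 0 < asc a n := ascPochhammer_pos n a ha

theorem asc_add (a : ℝ) (m n : ℕ) : asc a (m + n) = asc a m * asc (a + m) n := by
  simp [asc, ← ascPochhammer_mul]

theorem asc_succ (a : ℝ) (n : ℕ) : asc a (n + 1) = asc a n * (a + n) := by
  rw [asc_add, asc_one]

theorem asc_succ' (a : ℝ) (n : ℕ) : asc a (n + 1) = a * asc (a + 1) n := by
  rw [add_comm n 1, asc_add, asc_one, Nat.cast_one]

theorem asc_le_asc {a b : ℝ} (ha : 0 < a) (hab : a ≤ b) (n : ℕ) : asc a n ≤ asc b n := by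
  induction n with
  | zero => simp [asc_zero]
  | succ n ih =>
    rw [asc_succ, asc_succ]
    have := asc_pos (ha.trans_le hab) n
    gcongr

/-- The series of `₁F₁(a;b;z)` converges for `0 < a ≤ b`. -/
theorem hasSum_F11 {a b : ℝ} (ha : 0 < a) (hab : a ≤ b) (z : ℝ) :
    HasSum (fun k : ℕ ↦ asc a k / asc b k * z ^ k / (k ! : ℝ)) (F11 a b z) := by
  refine (Summable.of_norm_bounded (Real.summable_pow_div_factorial z).norm fun k ↦ ?_).hasSum
  have hb := asc_pos (ha.trans_le hab) k
  rw [mul_div_assoc, norm_mul]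
  refine mul_le_of_le_one_left (norm_nonneg _) ?_
  rw [Real.norm_of_nonneg (div_nonneg (asc_pos ha k).le hb.le)]
  exact (div_le_one hb).2 (asc_le_asc ha hab k)

/-- The Chu-Vandermonde summation of `₂F₁(-r,-k;a;1)`. -/
theorem sum_choose_mul_descFactorial_div_asc {a : ℝ} (ha : 0 < a) (r k : ℕ) :
    ∑ i ∈ Finset.range (r + 1), (r.choose i : ℝ) * (k.descFactorial i : ℝ) / asc a i =
      asc (a + k) r / asc a r := by
  induction r generalizing a k with
  | zero => simp [asc_zero]
  | succ r ih =>
    have key : ∑ i ∈ Finset.range (r + 2),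
          ((r + 1).choose i : ℝ) * (k.descFactorial i : ℝ) / asc a i =
        asc (a + k) r / asc a r + ∑ i ∈ Finset.range (r + 1),
          (r.choose i : ℝ) * (k.descFactorial (i + 1) : ℝ) / asc a (i + 1) := by
      rw [← ih ha k, Finset.sum_range_succ']
      have h := Finset.sum_range_succ
        (fun i ↦ (r.choose i : ℝ) * (k.descFactorial i : ℝ) / asc a i) (r + 1)
      rw [Finset.sum_range_succ'] at h
      simp only [Nat.choose_succ_self, Nat.cast_zero, zero_mul, zero_div, add_zero] at h
      rw [← h]
      simp only [Nat.choose_succ_succ, Nat.cast_add, add_mul, add_div, Finset.sum_add_distrib,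
        Nat.choose_zero_right]
      ring
    have shift : ∑ i ∈ Finset.range (r + 1),
          (r.choose i : ℝ) * (k.descFactorial (i + 1) : ℝ) / asc a (i + 1) =
        k / a * (asc (a + k) r / asc (a + 1) r) := by
      cases k with
      | zero => simp
      | succ k =>
        have h := ih (a := a + 1) (by linarith) k
        rw [show a + 1 + (k : ℝ) = a + (k + 1 : ℕ) by push_cast; ring] at h
        rw [← h, Finset.mul_sum]
        refine Finset.sum_congr rfl fun i _ ↦ ?_
        have := (asc_pos (show 0 < a + 1 by linarith) i).ne'
        rw [Nat.succ_descFactorial_succ, asc_succ']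
        push_cast
        field_simp
    have h0 := (asc_pos ha r).ne'
    have h1 := (asc_pos (show 0 < a + 1 by linarith) r).ne'
    have h2 : asc a r * (a + r) = a * asc (a + 1) r := by rw [← asc_succ, asc_succ']
    have h3 : a + r ≠ 0 := by positivity
    rw [key, shift, div_mul_div_comm, ← h2, asc_succ, asc_succ]
    field_simp
    ring

theorem asc_add_div_asc {a : ℝ} (ha : 0 < a) (r k : ℕ) :
    asc (a + r) k / asc a k = asc (a + k) r / asc a r := by
  rw [div_eq_div_iff (asc_pos ha k).ne' (asc_pos ha r).ne', mul_comm, ← asc_add, mul_comm,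
    ← asc_add, add_comm]

/-- A shifted `₁F₁` series, written as a power series in `z`. -/
theorem hasSum_pow_mul_F11 {c d : ℝ} (hc : 0 < c) (hcd : c ≤ d) (z : ℝ) (i : ℕ) :
    HasSum (fun k : ℕ ↦ asc c k / asc d k * z ^ k / (k ! : ℝ) * (k.descFactorial i : ℝ))
      (asc c i * z ^ i / asc d i * F11 (c + i) (d + i) z) := by
  rw [← (add_left_injective i).hasSum_iff]
  · refine ((hasSum_F11 (by positivity) (by gcongr) z).mul_left _).congr_fun fun k ↦ ?_
    have hd := hc.trans_le hcd
    have h1 := (asc_pos hd i).ne'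
    have h2 := (asc_pos (show 0 < d + i by positivity) k).ne'
    have h3 : ((k + i) ! : ℝ) = k ! * ((k + i).descFactorial i : ℝ) := by
      have := Nat.factorial_mul_descFactorial (Nat.le_add_left i k)
      rw [Nat.add_sub_cancel] at this
      exact_mod_cast this.symm
    have h4 : ((k + i).descFactorial i : ℝ) ≠ 0 := by
      intro h
      rw [h, mul_zero] at h3
      exact Nat.cast_ne_zero.2 (Nat.factorial_ne_zero _) h3
    simp only [Function.comp_apply]
    rw [h3, add_comm k i, asc_add, asc_add, pow_add]
    rw [add_comm k i] at h4
    field_simp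
  · intro k hk
    have : k < i := by
      by_contra! h
      exact hk ⟨k - i, Nat.sub_add_cancel h⟩
    simp [Nat.descFactorial_of_lt this]

/-- Identity between hypergeometric functions:
`₂F₂(α1+r, α⁺; α1, α⁺+r; λ/2) = Σ_{i=0}^{r} [C(r,i)(α⁺)_i(λ/2)^i/((α1)_i(α⁺+r)_i)]
·₁F₁(α⁺+i; α⁺+r+i; λ/2)`. -/
theorem hypergeometric_2F2_identity (α1 α2 lam : ℝ)
    (hα1 : 0 < α1) (hα2 : 0 < α2) (hlam : 0 ≤ lam) (r : ℕ) :
    F22 (α1 + r) (α1 + α2) α1 (α1 + α2 + r) (lam / 2) =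
      ∑ i ∈ Finset.range (r + 1),
        ((r.choose i : ℝ) * asc (α1 + α2) i * (lam / 2) ^ i /
            (asc α1 i * asc (α1 + α2 + r) i)) *
          F11 (α1 + α2 + i) (α1 + α2 + r + i) (lam / 2) := by
  have hc : 0 < α1 + α2 := by positivity
  have hcr : α1 + α2 ≤ α1 + α2 + r := le_add_of_nonneg_right r.cast_nonneg
  have hsum := hasSum_sum (s := Finset.range (r + 1)) fun i _ ↦
    (hasSum_pow_mul_F11 hc hcr (lam / 2) i).mul_left ((r.choose i : ℝ) / asc α1 i)
  calc
    _ = _ := tsum_congr fun k ↦ ?_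
    _ = _ := hsum.tsum_eq
    _ = _ := Finset.sum_congr rfl fun i _ ↦ ?_
  · rw [mul_div_mul_comm, asc_add_div_asc hα1, ← sum_choose_mul_descFactorial_div_asc hα1,
      mul_assoc, mul_div_assoc, Finset.sum_mul]
    exact Finset.sum_congr rfl fun i _ ↦ by ring
  · ring
end

section
/- Let λ1, λ2 ≥ 0 with λ⁺ = λ1 + λ2 > 0. Then the mean M = Σ_{j=0}^{∞} Σ_{k=0}^{∞} (e^{−λ1/2}(λ1/2)^j/j!)·(e^{−λ2/2}(λ2/2)^k/k!)·(1+j)/(2+j+k) of the doubly non-central beta distribution with both shape parameters equal to 1 and non-centrality parameters λ1, λ2 satisfies M = 1/2 + [(λ1−λ2)/(2(λ⁺)³)]·[(λ⁺)² − 4λ⁺ + 8 − 8·e^{−λ⁺/2}]. -/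
open scoped Nat

theorem sum_antidiagonal_pow_div_factorial (a b : ℝ) (n : ℕ) :
    ∑ p ∈ Finset.HasAntidiagonal.antidiagonal n, a ^ p.1 / (p.1 ! : ℝ) * (b ^ p.2 / (p.2 ! : ℝ)) =
      (a + b) ^ n / (n ! : ℝ) := by
  rw [(Commute.all a b).add_pow', Finset.sum_div]
  refine Finset.sum_congr rfl fun p hp => ?_
  rw [Finset.HasAntidiagonal.mem_antidiagonal] at hp
  subst hp
  rw [nsmul_eq_mul, Nat.cast_add_choose]
  field_simp

theorem sum_antidiagonal_fst_mul_pow_div_factorial (a b : ℝ) (n : ℕ) :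
    (a + b) * ∑ p ∈ Finset.HasAntidiagonal.antidiagonal n,
        (p.1 : ℝ) * (a ^ p.1 / (p.1 ! : ℝ) * (b ^ p.2 / (p.2 ! : ℝ))) =
      a * (n * ((a + b) ^ n / (n ! : ℝ))) := by
  cases n with
  | zero => simp
  | succ n =>
    have h : ∀ p : ℕ × ℕ, ((p.1 + 1 : ℕ) : ℝ) *
        (a ^ (p.1 + 1) / ((p.1 + 1)! : ℝ) * (b ^ p.2 / (p.2 ! : ℝ))) =
        a * (a ^ p.1 / (p.1 ! : ℝ) * (b ^ p.2 / (p.2 ! : ℝ))) := fun p => by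
      rw [Nat.factorial_succ]
      push_cast
      field_simp
      ring
    rw [Finset.Nat.sum_antidiagonal_succ]
    simp only [h, ← Finset.mul_sum, sum_antidiagonal_pow_div_factorial]
    rw [Nat.factorial_succ]
    push_cast
    field_simp
    ring

theorem hasSum_pow_div_factorial (s : ℝ) :
    HasSum (fun n : ℕ => s ^ n / (n ! : ℝ)) (Real.exp s) := by
  rw [Real.exp_eq_exp_ℝ]
  exact NormedSpace.expSeries_div_hasSum_exp s

theorem hasSum_pow_div_factorial_div_add_two {s : ℝ} (hs : s ≠ 0) :
    HasSum (fun n : ℕ => s ^ n / (n ! : ℝ) / (n + 2)) (((s - 1) * Real.exp s + 1) / s ^ 2) := by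
  have h1 := (hasSum_nat_add_iff' 1).mpr (hasSum_pow_div_factorial s)
  have h2 := (hasSum_nat_add_iff' 2).mpr (hasSum_pow_div_factorial s)
  convert ((h1.mul_left s).sub h2).mul_right (s ^ 2)⁻¹ using 1
  · rfl
  · funext n
    rw [Nat.factorial_succ (n + 1), Nat.factorial_succ n]
    push_cast
    have : (n : ℝ) + 1 + 1 ≠ 0 := by positivity
    have : (n : ℝ) + 2 ≠ 0 := by positivity
    field_simp
    ring
  · simp [Finset.sum_range_succ]
    ring

theorem sum_antidiagonal_mul_ratio {a b : ℝ} (hs : a + b ≠ 0) (n : ℕ) :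
    ∑ p ∈ Finset.HasAntidiagonal.antidiagonal n, a ^ p.1 / (p.1 ! : ℝ) * (b ^ p.2 / (p.2 ! : ℝ)) *
        ((1 + p.1) / (2 + p.1 + p.2)) =
      a / (a + b) * ((a + b) ^ n / (n ! : ℝ)) +
        (b - a) / (a + b) * ((a + b) ^ n / (n ! : ℝ) / (n + 2)) := by
  have hn : (n : ℝ) + 2 ≠ 0 := by positivity
  have h0 := sum_antidiagonal_pow_div_factorial a b n
  have h1 := sum_antidiagonal_fst_mul_pow_div_factorial a b n
  rw [mul_comm, ← eq_div_iff hs] at h1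
  trans (∑ p ∈ Finset.HasAntidiagonal.antidiagonal n, a ^ p.1 / (p.1 ! : ℝ) * (b ^ p.2 / (p.2 ! : ℝ)) +
    ∑ p ∈ Finset.HasAntidiagonal.antidiagonal n,
      (p.1 : ℝ) * (a ^ p.1 / (p.1 ! : ℝ) * (b ^ p.2 / (p.2 ! : ℝ)))) / (n + 2)
  · rw [← Finset.sum_add_distrib, Finset.sum_div]
    refine Finset.sum_congr rfl fun p hp => ?_
    rw [Finset.HasAntidiagonal.mem_antidiagonal] at hp
    rw [add_assoc, ← Nat.cast_add, hp]
    ring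
  · rw [h0, h1]
    field_simp
    ring

theorem summable_pow_div_factorial_mul_ratio (a b : ℝ) :
    Summable fun p : ℕ × ℕ => a ^ p.1 / (p.1 ! : ℝ) * (b ^ p.2 / (p.2 ! : ℝ)) *
      ((1 + p.1) / (2 + p.1 + p.2)) := by
  have h := summable_mul_of_summable_norm (hasSum_pow_div_factorial a).summable.norm
    (hasSum_pow_div_factorial b).summable.norm
  refine Summable.of_norm_bounded h.norm fun p => ?_
  rw [norm_mul]
  refine mul_le_of_le_one_right (norm_nonneg _) ?_
  rw [Real.norm_of_nonneg (by positivity)]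
  refine div_le_one_of_le₀ ?_ (by positivity)
  have : (0 : ℝ) ≤ p.2 := by positivity
  linarith

theorem tsum_tsum_eq_tsum_sum_antidiagonal {f : ℕ × ℕ → ℝ} (hf : Summable f) :
    ∑' j, ∑' k, f (j, k) = ∑' n, ∑ p ∈ Finset.HasAntidiagonal.antidiagonal n, f p := by
  have h := (Finset.HasAntidiagonal.sigmaAntidiagonalEquivProd.summable_iff.mpr hf).tsum_sigma
  rw [← hf.tsum_prod, ← Finset.HasAntidiagonal.sigmaAntidiagonalEquivProd.tsum_eq f]
  refine h.trans (tsum_congr fun n => ?_)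
  exact Finset.tsum_subtype (Finset.HasAntidiagonal.antidiagonal n) f

theorem tsum_tsum_pow_div_factorial_mul_ratio {a b : ℝ} (hs : a + b ≠ 0) :
    ∑' j : ℕ, ∑' k : ℕ, a ^ j / (j ! : ℝ) * (b ^ k / (k ! : ℝ)) * ((1 + j) / (2 + j + k)) =
      a / (a + b) * Real.exp (a + b) +
        (b - a) / (a + b) * (((a + b - 1) * Real.exp (a + b) + 1) / (a + b) ^ 2) := by
  rw [tsum_tsum_eq_tsum_sum_antidiagonal (summable_pow_div_factorial_mul_ratio a b)]
  simp only [sum_antidiagonal_mul_ratio hs]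
  exact (((hasSum_pow_div_factorial _).mul_left _).add
    ((hasSum_pow_div_factorial_div_add_two hs).mul_left _)).tsum_eq

/-- Mean of the doubly non-central beta distribution with both shape parameters equal to `1`:
`M = 1/2 + [(λ1−λ2)/(2(λ⁺)³)]·[(λ⁺)² − 4λ⁺ + 8 − 8e^{−λ⁺/2}]`. -/
theorem dncBeta_one_one_mean (lam1 lam2 : ℝ) (hl1 : 0 ≤ lam1) (hl2 : 0 ≤ lam2)
    (hlsum : 0 < lam1 + lam2) :
    (∑' j : ℕ, ∑' k : ℕ,
        (Real.exp (-(lam1 / 2)) * (lam1 / 2) ^ j / (j ! : ℝ)) *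
          (Real.exp (-(lam2 / 2)) * (lam2 / 2) ^ k / (k ! : ℝ)) *
          ((1 + j) / (2 + j + k) : ℝ)) =
      1 / 2 + ((lam1 - lam2) / (2 * (lam1 + lam2) ^ 3)) *
        ((lam1 + lam2) ^ 2 - 4 * (lam1 + lam2) + 8 -
          8 * Real.exp (-((lam1 + lam2) / 2))) := by
  have hs : lam1 / 2 + lam2 / 2 ≠ 0 := by linarith
  have key := tsum_tsum_pow_div_factorial_mul_ratio hs
  have hfactor : ∀ j k : ℕ,
      (Real.exp (-(lam1 / 2)) * (lam1 / 2) ^ j / (j ! : ℝ)) *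
          (Real.exp (-(lam2 / 2)) * (lam2 / 2) ^ k / (k ! : ℝ)) *
          ((1 + j) / (2 + j + k) : ℝ) =
        Real.exp (-((lam1 + lam2) / 2)) * ((lam1 / 2) ^ j / (j ! : ℝ) *
          ((lam2 / 2) ^ k / (k ! : ℝ)) * ((1 + j) / (2 + j + k))) := fun j k => by
    rw [show -((lam1 + lam2) / 2) = -(lam1 / 2) + -(lam2 / 2) by ring, Real.exp_add]
    ring
  simp only [hfactor, tsum_mul_left]
  rw [key, ← add_div, Real.exp_neg]
  have hE := Real.exp_ne_zero ((lam1 + lam2) / 2)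
  have hl := hlsum.ne'
  field_simp
  ring
end
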